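/- arXiv:2305.05368 — 4 statements merged into one kernel-verified Lean document; each statement's English description precedes it below -/
import Mathlib

section
/- For every vector x ∈ ℝ^V one has xᵀ N x ≥ 2 xᵀ D̃^{-1} x − xᵀ x, where N = D̃^{-1/2} (A + I) D̃^{-1/2}. Consequently, for every nonzero x ∈ ℝ^V one has xᵀ (N + I) x > 0, i.e., N + I is positive definite. -/
open Matrix

/-- The symmetrically normalized adjacency matrix with self-loops,
`N = D̃^{-1/2} (A + I) D̃^{-1/2}` where `D̃ = D + I`. -/
noncomputable def nMat {V : Type*} [Fintype V] [DecidableEq V]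
    (G : SimpleGraph V) [DecidableRel G.Adj] : Matrix V V ℝ :=
  (Matrix.diagonal fun i => 1 / Real.sqrt ((G.degree i : ℝ) + 1)) *
    (G.adjMatrix ℝ + 1) *
    (Matrix.diagonal fun i => 1 / Real.sqrt ((G.degree i : ℝ) + 1))

/-- The signless Laplacian `D + A` is a sum of squares over adjacent pairs of vertices. -/
theorem SimpleGraph.dotProduct_signlessLaplacian_mulVec {V : Type*} [Fintype V] [DecidableEq V]
    (G : SimpleGraph V) [DecidableRel G.Adj] (y : V → ℝ) :
    y ⬝ᵥ ((G.degMatrix ℝ + G.adjMatrix ℝ) *ᵥ y) =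
      (∑ i, ∑ j, if G.Adj i j then (y i + y j) ^ 2 else 0) / 2 := by
  have hdeg : ∑ i, ∑ j, (if G.Adj i j then y i ^ 2 else 0) = y ⬝ᵥ (G.degMatrix ℝ *ᵥ y) := by
    simp only [dotProduct, degMatrix_mulVec_apply, degree_eq_sum_if_adj, Finset.sum_mul,
      Finset.mul_sum]
    refine Finset.sum_congr rfl fun i _ => Finset.sum_congr rfl fun j _ => ?_
    split_ifs <;> ring
  have hdeg' : ∑ i, ∑ j, (if G.Adj i j then y j ^ 2 else 0) = y ⬝ᵥ (G.degMatrix ℝ *ᵥ y) := by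
    rw [Finset.sum_comm, ← hdeg]
    simp only [G.adj_comm]
  have hadj : ∑ i, ∑ j, (if G.Adj i j then y i * y j else 0) = y ⬝ᵥ (G.adjMatrix ℝ *ᵥ y) := by
    simp only [dotProduct, mulVec, adjMatrix_apply, Finset.mul_sum]
    refine Finset.sum_congr rfl fun i _ => Finset.sum_congr rfl fun j _ => ?_
    split_ifs <;> ring
  have hsplit : ∑ i, ∑ j, (if G.Adj i j then (y i + y j) ^ 2 else 0) =
      ∑ i, ∑ j, (if G.Adj i j then y i ^ 2 else 0) +
        2 * ∑ i, ∑ j, (if G.Adj i j then y i * y j else 0) +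
          ∑ i, ∑ j, (if G.Adj i j then y j ^ 2 else 0) := by
    simp only [Finset.mul_sum, ← Finset.sum_add_distrib]
    refine Finset.sum_congr rfl fun i _ => Finset.sum_congr rfl fun j _ => ?_
    split_ifs <;> ring
  rw [hsplit, hdeg, hdeg', hadj, add_mulVec, dotProduct_add]
  ring

theorem SimpleGraph.dotProduct_signlessLaplacian_mulVec_nonneg
    {V : Type*} [Fintype V] [DecidableEq V]
    (G : SimpleGraph V) [DecidableRel G.Adj] (y : V → ℝ) :
    0 ≤ y ⬝ᵥ ((G.degMatrix ℝ + G.adjMatrix ℝ) *ᵥ y) := by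
  rw [G.dotProduct_signlessLaplacian_mulVec]
  positivity

/-- After the substitution `y = D̃^{-1/2} x`, the gap `xᵀ N x + xᵀ x - 2 xᵀ D̃⁻¹ x` is the
quadratic form of the signless Laplacian at `y`. -/
theorem dotProduct_nMat_mulVec {V : Type*} [Fintype V] [DecidableEq V]
    (G : SimpleGraph V) [DecidableRel G.Adj] (x : V → ℝ) :
    x ⬝ᵥ (nMat G *ᵥ x) =
      2 * (x ⬝ᵥ ((Matrix.diagonal fun i => 1 / ((G.degree i : ℝ) + 1)) *ᵥ x)) - x ⬝ᵥ x +
        (fun i => x i / √((G.degree i : ℝ) + 1)) ⬝ᵥ ((G.degMatrix ℝ + G.adjMatrix ℝ) *ᵥ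
          fun i => x i / √((G.degree i : ℝ) + 1)) := by
  set y : V → ℝ := fun i => x i / √((G.degree i : ℝ) + 1) with hy
  have hright : (Matrix.diagonal fun i => 1 / √((G.degree i : ℝ) + 1)) *ᵥ x = y := by
    ext i
    simp [mulVec_diagonal, hy, div_eq_inv_mul]
  have hleft : x ᵥ* (Matrix.diagonal fun i => 1 / √((G.degree i : ℝ) + 1)) = y := by
    ext i
    simp [vecMul_diagonal, hy, div_eq_mul_inv]
  have hN : x ⬝ᵥ (nMat G *ᵥ x) = y ⬝ᵥ (G.adjMatrix ℝ *ᵥ y) + y ⬝ᵥ y := by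
    rw [nMat, ← mulVec_mulVec, ← mulVec_mulVec, hright, dotProduct_mulVec, hleft, add_mulVec,
      one_mulVec, dotProduct_add]
  have hdiag : y ⬝ᵥ y =
      2 * (x ⬝ᵥ ((Matrix.diagonal fun i => 1 / ((G.degree i : ℝ) + 1)) *ᵥ x)) - x ⬝ᵥ x +
        y ⬝ᵥ (G.degMatrix ℝ *ᵥ y) := by
    simp only [dotProduct, mulVec_diagonal, SimpleGraph.degMatrix_mulVec_apply, Finset.mul_sum,
      ← Finset.sum_sub_distrib, ← Finset.sum_add_distrib]
    refine Finset.sum_congr rfl fun i _ => ?_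
    have hpos : (0 : ℝ) < G.degree i + 1 := by positivity
    have hsq : y i * y i = x i * x i / (G.degree i + 1) := by
      rw [hy, div_mul_div_comm, Real.mul_self_sqrt hpos.le]
    rw [mul_left_comm (y i), hsq]
    field_simp
    ring
  rw [hN, hdiag, add_mulVec, dotProduct_add]
  ring

/-- For every `x : V → ℝ`, `xᵀ N x ≥ 2 xᵀ D̃⁻¹ x − xᵀ x`; consequently for every
nonzero `x`, `xᵀ (N + I) x > 0`, i.e. `N + I` is positive definite. -/
theorem nMat_add_one_posDef
    {V : Type*} [Fintype V] [DecidableEq V]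
    (G : SimpleGraph V) [DecidableRel G.Adj] :
    (∀ x : V → ℝ,
        x ⬝ᵥ (nMat G *ᵥ x) ≥
          2 * (x ⬝ᵥ ((Matrix.diagonal fun i => 1 / ((G.degree i : ℝ) + 1)) *ᵥ x))
            - x ⬝ᵥ x) ∧
    (∀ x : V → ℝ, x ≠ 0 → 0 < x ⬝ᵥ ((nMat G + 1) *ᵥ x)) := by
  have hlower : ∀ x : V → ℝ, x ⬝ᵥ (nMat G *ᵥ x) ≥
      2 * (x ⬝ᵥ ((Matrix.diagonal fun i => 1 / ((G.degree i : ℝ) + 1)) *ᵥ x)) - x ⬝ᵥ x :=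
    fun x => by
      rw [dotProduct_nMat_mulVec]
      exact le_add_of_nonneg_right (G.dotProduct_signlessLaplacian_mulVec_nonneg _)
  refine ⟨hlower, fun x hx => ?_⟩
  have hD : (Matrix.diagonal fun i => 1 / ((G.degree i : ℝ) + 1)).PosDef :=
    PosDef.diagonal fun i => by positivity
  have hpos := hD.dotProduct_mulVec_pos hx
  rw [star_trivial] at hpos
  rw [add_mulVec, one_mulVec, dotProduct_add]
  linarith [hlower x]
end

section
/- The matrix N = D̃^{-1/2} (A + I) D̃^{-1/2} is real symmetric, and every eigenvalue λ of N satisfies −1 < λ ≤ 1. -/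
open Matrix

/-- An eigenvector of `nMat G` rescales by `D̃^{-1/2}` to a nonzero solution of the generalized
eigenvalue equation `(A + I) y = μ D̃ y`. -/
theorem exists_generalized_eigenvector_of_hasEigenvalue_nMat
    {V : Type*} [Fintype V] [DecidableEq V] (G : SimpleGraph V) [DecidableRel G.Adj] {μ : ℝ}
    (h : Module.End.HasEigenvalue (Matrix.toLin' (nMat G)) μ) :
    ∃ y : V → ℝ, y ≠ 0 ∧
      ∀ i, ∑ j ∈ G.neighborFinset i, y j + y i = μ * (((G.degree i : ℝ) + 1) * y i) := by
  obtain ⟨x, hx⟩ := h.exists_hasEigenvector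
  have hpos (i : V) : 0 < Real.sqrt ((G.degree i : ℝ) + 1) := Real.sqrt_pos.2 (by positivity)
  refine ⟨fun i => 1 / Real.sqrt ((G.degree i : ℝ) + 1) * x i, fun h0 => hx.2 ?_, fun i => ?_⟩
  · funext i
    have hi := congrFun h0 i
    simpa [(hpos i).ne'] using hi
  · have hi := congrFun hx.apply_eq_smul i
    have hsq := Real.mul_self_sqrt (show (0 : ℝ) ≤ (G.degree i : ℝ) + 1 by positivity)
    have hdiag : (Matrix.diagonal fun i => 1 / Real.sqrt ((G.degree i : ℝ) + 1)) *ᵥ x =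
        fun i => 1 / Real.sqrt ((G.degree i : ℝ) + 1) * x i :=
      funext fun j => Matrix.mulVec_diagonal _ _ j
    rw [Matrix.toLin'_apply, nMat, ← Matrix.mulVec_mulVec, ← Matrix.mulVec_mulVec, hdiag,
      Matrix.mulVec_diagonal, Matrix.add_mulVec, Matrix.one_mulVec, Pi.add_apply,
      SimpleGraph.adjMatrix_mulVec_apply, Pi.smul_apply, smul_eq_mul, one_div_mul_eq_div,
      div_eq_iff (hpos i).ne'] at hi
    have hne := (hpos i).ne'
    rw [hi]
    beta_reduce
    generalize Real.sqrt ((G.degree i : ℝ) + 1) = s at hsq hne ⊢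
    rw [← hsq]
    field_simp

/-- A sum over the neighbors of a vertex where `|y|` is maximal is controlled by the degree. -/
theorem abs_mul_sum_neighborFinset_le {V : Type*} [Fintype V] (G : SimpleGraph V)
    [DecidableRel G.Adj] (y : V → ℝ) {i : V} (hi : ∀ j, |y j| ≤ |y i|) :
    |y i * ∑ j ∈ G.neighborFinset i, y j| ≤ G.degree i * y i ^ 2 := by
  have hsum : |∑ j ∈ G.neighborFinset i, y j| ≤ G.degree i * |y i| := by
    refine (Finset.abs_sum_le_sum_abs _ _).trans ?_
    simpa using Finset.sum_le_card_nsmul (G.neighborFinset i) (fun j => |y j|) |y i|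
      fun j _ => hi j
  calc |y i * ∑ j ∈ G.neighborFinset i, y j| ≤ |y i| * (G.degree i * |y i|) := by
        rw [abs_mul]; gcongr
    _ = G.degree i * y i ^ 2 := by rw [← sq_abs]; ring

/-- The matrix `N = D̃^{-1/2}(A+I)D̃^{-1/2}` is real symmetric and every (real)
eigenvalue `μ` of `N` satisfies `−1 < μ ≤ 1`. -/
theorem nMat_isSymm_and_eigenvalue_bounds
    {V : Type*} [Fintype V] [DecidableEq V]
    (G : SimpleGraph V) [DecidableRel G.Adj] :
    (nMat G).IsSymm ∧
    ∀ μ : ℝ, Module.End.HasEigenvalue (Matrix.toLin' (nMat G)) μ → -1 < μ ∧ μ ≤ 1 := by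
  refine ⟨?_, fun μ hμ => ?_⟩
  · simp [Matrix.IsSymm, nMat, Matrix.transpose_mul, Matrix.mul_assoc]
  · obtain ⟨y, hy0, hy⟩ := exists_generalized_eigenvector_of_hasEigenvalue_nMat G hμ
    obtain ⟨k, hk⟩ := Function.ne_iff.1 hy0
    have : Nonempty V := ⟨k⟩
    obtain ⟨i, hi⟩ := Finite.exists_max fun j => |y j|
    have hyi : 0 < y i ^ 2 := by
      rw [← sq_abs]
      exact pow_pos ((abs_pos.2 hk).trans_le (hi k)) 2
    obtain ⟨hlo, hhi⟩ := abs_le.1 (abs_mul_sum_neighborFinset_le G y hi)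
    have hd : (0 : ℝ) ≤ G.degree i := by positivity
    have heq : y i * ∑ j ∈ G.neighborFinset i, y j =
        (μ * ((G.degree i : ℝ) + 1) - 1) * y i ^ 2 := by
      linear_combination y i * hy i
    rw [heq] at hlo hhi
    rw [← neg_mul] at hlo
    have hlo' := le_of_mul_le_mul_right hlo hyi
    have hhi' := le_of_mul_le_mul_right hhi hyi
    constructor <;> nlinarith
end

section
/- Let Λ ∈ ℝ^{V×V} be a diagonal matrix all of whose diagonal entries satisfy 0 < Λ_ii < 1. Then the matrix N + Λ^{-1} is positive definite: for every nonzero x ∈ ℝ^V, xᵀ (N + Λ^{-1}) x > 0, where N = D̃^{-1/2} (A + I) D̃^{-1/2}. -/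
open Matrix

/-- The signless Laplacian `D + A` of a graph is positive semidefinite. -/
theorem SimpleGraph.sum_degree_mul_sq_add_dotProduct_adjMatrix_mulVec_nonneg
    {V : Type*} [Fintype V] (G : SimpleGraph V) [DecidableRel G.Adj] (y : V → ℝ) :
    0 ≤ ∑ i, (G.degree i : ℝ) * y i ^ 2 + y ⬝ᵥ (G.adjMatrix ℝ *ᵥ y) := by
  have row_sum (i : V) : ∑ j, G.adjMatrix ℝ i j = G.degree i := by
    simpa [mulVec, dotProduct] using G.adjMatrix_mulVec_const_apply (α := ℝ) (a := 1) (v := i)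
  have fst : ∑ i, ∑ j, G.adjMatrix ℝ i j * y i ^ 2 = ∑ i, (G.degree i : ℝ) * y i ^ 2 := by
    simp_rw [← Finset.sum_mul, row_sum]
  have snd : ∑ i, ∑ j, G.adjMatrix ℝ i j * y j ^ 2 = ∑ i, (G.degree i : ℝ) * y i ^ 2 := by
    rw [Finset.sum_comm, ← fst]
    simp_rw [SimpleGraph.adjMatrix_apply, G.adj_comm]
  have cross : ∑ i, ∑ j, G.adjMatrix ℝ i j * (y i * y j) = y ⬝ᵥ (G.adjMatrix ℝ *ᵥ y) := by
    simp only [dotProduct, mulVec, Finset.mul_sum]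
    exact Finset.sum_congr rfl fun i _ => Finset.sum_congr rfl fun j _ => by ring
  have expand : ∑ i, ∑ j, G.adjMatrix ℝ i j * (y i + y j) ^ 2 =
      ∑ i, ∑ j, G.adjMatrix ℝ i j * y i ^ 2 + ∑ i, ∑ j, G.adjMatrix ℝ i j * y j ^ 2 +
        2 * ∑ i, ∑ j, G.adjMatrix ℝ i j * (y i * y j) := by
    simp only [Finset.mul_sum, ← Finset.sum_add_distrib]
    exact Finset.sum_congr rfl fun i _ => Finset.sum_congr rfl fun j _ => by ring
  have nonneg : 0 ≤ ∑ i, ∑ j, G.adjMatrix ℝ i j * (y i + y j) ^ 2 :=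
    Finset.sum_nonneg fun i _ => Finset.sum_nonneg fun j _ =>
      mul_nonneg (by rw [SimpleGraph.adjMatrix_apply]; split_ifs <;> norm_num) (sq_nonneg _)
  linarith

/-- All eigenvalues of `nMat G` are at least `-1`. -/
theorem dotProduct_self_add_dotProduct_nMat_mulVec_nonneg
    {V : Type*} [Fintype V] [DecidableEq V] (G : SimpleGraph V) [DecidableRel G.Adj]
    (x : V → ℝ) : 0 ≤ x ⬝ᵥ x + x ⬝ᵥ (nMat G *ᵥ x) := by
  set y : V → ℝ := fun i => 1 / √((G.degree i : ℝ) + 1) * x i with hy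
  have quad : x ⬝ᵥ (nMat G *ᵥ x) = y ⬝ᵥ (G.adjMatrix ℝ *ᵥ y) + y ⬝ᵥ y := by
    have scale : (diagonal fun i => 1 / √((G.degree i : ℝ) + 1)) *ᵥ x = y :=
      funext fun i => mulVec_diagonal _ _ i
    have scale' : x ᵥ* (diagonal fun i => 1 / √((G.degree i : ℝ) + 1)) = y :=
      funext fun i => (vecMul_diagonal _ _ i).trans (mul_comm _ _)
    rw [nMat, ← mulVec_mulVec, ← mulVec_mulVec, scale, dotProduct_mulVec, scale', add_mulVec,
      one_mulVec, dotProduct_add]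
  have norm : x ⬝ᵥ x = ∑ i, (G.degree i : ℝ) * y i ^ 2 + y ⬝ᵥ y := by
    simp only [dotProduct, ← Finset.sum_add_distrib]
    refine Finset.sum_congr rfl fun i _ => ?_
    have hpos : (0 : ℝ) < (G.degree i : ℝ) + 1 := by positivity
    have hsq : ((G.degree i : ℝ) + 1) * (1 / √((G.degree i : ℝ) + 1)) ^ 2 = 1 := by
      rw [div_pow, Real.sq_sqrt hpos.le, one_pow, mul_one_div_cancel hpos.ne']
    simp only [hy]
    linear_combination -(x i ^ 2) * hsq
  have signless := G.sum_degree_mul_sq_add_dotProduct_adjMatrix_mulVec_nonneg y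
  have self_nonneg : 0 ≤ y ⬝ᵥ y := Finset.sum_nonneg fun i _ => mul_self_nonneg (y i)
  linarith

/-- If `Λ` is a diagonal matrix with diagonal entries in `(0,1)`, then
`N + Λ⁻¹` is positive definite: `xᵀ (N + Λ⁻¹) x > 0` for every nonzero `x`. -/
theorem nMat_add_inv_diagonal_posDef
    {V : Type*} [Fintype V] [DecidableEq V]
    (G : SimpleGraph V) [DecidableRel G.Adj]
    (Λ : V → ℝ) (hΛ : ∀ i, 0 < Λ i ∧ Λ i < 1) :
    ∀ x : V → ℝ, x ≠ 0 →
      0 < x ⬝ᵥ ((nMat G + Matrix.diagonal fun i => (Λ i)⁻¹) *ᵥ x) := by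
  intro x hx
  have dominate : x ⬝ᵥ x < x ⬝ᵥ ((diagonal fun i => (Λ i)⁻¹) *ᵥ x) := by
    have inv_gt (i : V) : 1 < (Λ i)⁻¹ := (one_lt_inv₀ (hΛ i).1).2 (hΛ i).2
    obtain ⟨k, hk⟩ := Function.ne_iff.1 hx
    simp only [dotProduct, mulVec_diagonal]
    refine Finset.sum_lt_sum (fun i _ => ?_) ⟨k, Finset.mem_univ k, ?_⟩
    · nlinarith [inv_gt i, mul_self_nonneg (x i)]
    · nlinarith [inv_gt k, mul_self_pos.2 hk]
  rw [add_mulVec, dotProduct_add]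
  linarith [dotProduct_self_add_dotProduct_nMat_mulVec_nonneg G x]
end

section
/- (Lemma 2) Let Λ ∈ ℝ^{V×V} be a diagonal matrix all of whose diagonal entries satisfy 0 < Λ_ii < 1. Then the matrix Λ N + I is invertible, where N = D̃^{-1/2} (A + I) D̃^{-1/2}. -/
open Matrix

/-- Row `i` of `N`, rescaled by `1 / √(d_i + 1)`, averages `x_j / √(d_j + 1)` over the closed
neighbourhood of `i`. -/
lemma nMat_mulVec_div_sqrt {V : Type*} [Fintype V] [DecidableEq V]
    (G : SimpleGraph V) [DecidableRel G.Adj] (x : V → ℝ) (i : V) :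
    (nMat G *ᵥ x) i / Real.sqrt ((G.degree i : ℝ) + 1) =
      (∑ j ∈ G.neighborFinset i, x j / Real.sqrt ((G.degree j : ℝ) + 1) +
        x i / Real.sqrt ((G.degree i : ℝ) + 1)) / ((G.degree i : ℝ) + 1) := by
  have hs : Real.sqrt ((G.degree i : ℝ) + 1) * Real.sqrt ((G.degree i : ℝ) + 1)
      = (G.degree i : ℝ) + 1 := Real.mul_self_sqrt (by positivity)
  simp only [nMat, ← Matrix.mulVec_mulVec, Matrix.mulVec_diagonal, Matrix.add_mulVec,
    Pi.add_apply, Matrix.one_mulVec, SimpleGraph.adjMatrix_mulVec_apply]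
  rw [one_div_mul_eq_div, div_div, hs]
  simp only [one_div_mul_eq_div]

/-- If `|y i|` is maximal, it bounds the average of `y` over the closed neighbourhood of `i`. -/
lemma abs_closedNeighborhood_average_le {V : Type*} [Fintype V]
    (G : SimpleGraph V) [DecidableRel G.Adj] (y : V → ℝ) (i : V)
    (hi : ∀ j, |y j| ≤ |y i|) :
    |(∑ j ∈ G.neighborFinset i, y j + y i) / ((G.degree i : ℝ) + 1)| ≤ |y i| := by
  have hd : (0 : ℝ) < (G.degree i : ℝ) + 1 := by positivity
  rw [abs_div, abs_of_pos hd, div_le_iff₀ hd]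
  calc |∑ j ∈ G.neighborFinset i, y j + y i|
      ≤ ∑ j ∈ G.neighborFinset i, |y j| + |y i| :=
        (abs_add_le _ _).trans (by gcongr; exact Finset.abs_sum_le_sum_abs _ _)
    _ ≤ ∑ j ∈ G.neighborFinset i, |y i| + |y i| :=
        add_le_add_left (Finset.sum_le_sum fun j _ => hi j) _
    _ = |y i| * ((G.degree i : ℝ) + 1) := by
        rw [Finset.sum_const, G.card_neighborFinset_eq_degree, nsmul_eq_mul]; ring

/-- (Lemma 2) If `Λ` is a diagonal matrix with all diagonal entries in `(0,1)`,
then the matrix `Λ N + I` is invertible. -/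
theorem diagonal_mul_nMat_add_one_isUnit
    {V : Type*} [Fintype V] [DecidableEq V]
    (G : SimpleGraph V) [DecidableRel G.Adj]
    (Λ : V → ℝ) (hΛ : ∀ i, 0 < Λ i ∧ Λ i < 1) :
    IsUnit (Matrix.diagonal Λ * nMat G + 1) := by
  rw [Matrix.isUnit_iff_isUnit_det, isUnit_iff_ne_zero, ne_eq, ← Matrix.exists_mulVec_eq_zero_iff]
  rintro ⟨x, hx, hker⟩
  obtain ⟨k, hk⟩ := Function.ne_iff.mp hx
  have : Nonempty V := ⟨k⟩
  set y : V → ℝ := fun j => x j / Real.sqrt ((G.degree j : ℝ) + 1)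
  obtain ⟨i, hi⟩ := Finite.exists_max fun j => |y j|
  have hyi : 0 < |y i| := by
    refine lt_of_lt_of_le (abs_pos.mpr (div_ne_zero hk ?_)) (hi k)
    exact (Real.sqrt_pos.mpr (by positivity)).ne'
  have hrow : Λ i * (nMat G *ᵥ x) i + x i = 0 := by
    simpa [Matrix.add_mulVec, ← Matrix.mulVec_mulVec, Matrix.mulVec_diagonal]
      using congrFun hker i
  have hyrow : y i = -(Λ i * ((nMat G *ᵥ x) i / Real.sqrt ((G.degree i : ℝ) + 1))) := by
    rw [← mul_div_assoc, ← neg_div, ← eq_neg_of_add_eq_zero_right hrow]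
  have hle : |y i| ≤ Λ i * |y i| := by
    conv_lhs => rw [hyrow, abs_neg, abs_mul, abs_of_pos (hΛ i).1, nMat_mulVec_div_sqrt]
    exact mul_le_mul_of_nonneg_left (abs_closedNeighborhood_average_le G y i hi) (hΛ i).1.le
  nlinarith [(hΛ i).2]
end
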